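/- arXiv:2103.04766 — 7 statements merged into one kernel-verified Lean document; each statement's English description precedes it below -/
import Mathlib

section
/- Let G be a connected finite simple graph on n ≥ 4 vertices, where n is even. If the matching number of G equals n/2, then the co-chordal cover number of G is strictly less than n/2. -/
variable {V : Type*}

/-- `M` is a matching of `G`: a finite collection of pairwise disjoint edges of `G`. -/
def IsMatchingFinset (G : SimpleGraph V) (M : Finset (Sym2 V)) : Prop :=
  (∀ e ∈ M, e ∈ G.edgeSet) ∧ ∀ e ∈ M, ∀ f ∈ M, e ≠ f → ∀ v : V, v ∈ e → v ∉ f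

/-- The matching number `mat(G)`: the maximum size of a matching of `G`. -/
noncomputable def matchingNumber (G : SimpleGraph V) : ℕ :=
  sSup { m | ∃ M : Finset (Sym2 V), IsMatchingFinset G M ∧ M.card = m }

/-- `M` is an induced matching of `G`: a matching such that the induced subgraph of `G`
on the union of the edges of `M` has exactly the edges of `M`. -/
def IsInducedMatchingFinset (G : SimpleGraph V) (M : Finset (Sym2 V)) : Prop :=
  IsMatchingFinset G M ∧ ∀ e ∈ G.edgeSet, (∀ v ∈ e, ∃ f ∈ M, v ∈ f) → e ∈ M

/-- The induced matching number `indm(G)`: the maximum size of an induced matching of `G`. -/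
noncomputable def inducedMatchingNumber (G : SimpleGraph V) : ℕ :=
  sSup { m | ∃ M : Finset (Sym2 V), IsInducedMatchingFinset G M ∧ M.card = m }

/-- `C` is a vertex cover of `G`: every edge of `G` contains a vertex of `C`. -/
def IsVertexCover (G : SimpleGraph V) (C : Finset V) : Prop :=
  ∀ e ∈ G.edgeSet, ∃ v ∈ C, v ∈ e

/-- `C` is a minimal vertex cover of `G`: no proper subset of `C` is a vertex cover. -/
def IsMinimalVertexCover (G : SimpleGraph V) (C : Finset V) : Prop :=
  IsVertexCover G C ∧ ∀ D : Finset V, D ⊂ C → ¬ IsVertexCover G D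

/-- `τ_max(G)`: the maximum cardinality of a minimal vertex cover of `G`. -/
noncomputable def tauMax (G : SimpleGraph V) : ℕ :=
  sSup { m | ∃ C : Finset V, IsMinimalVertexCover G C ∧ C.card = m }

/-- `(A, B)` is a bipartition of `G`: the vertex set is partitioned into the two
independent sets `A` and `B`. -/
def IsBipartition (G : SimpleGraph V) (A B : Set V) : Prop :=
  (∀ v, v ∈ A ∨ v ∈ B) ∧ (∀ v, ¬(v ∈ A ∧ v ∈ B)) ∧
    (∀ u v, G.Adj u v → ¬(u ∈ A ∧ v ∈ A)) ∧ (∀ u v, G.Adj u v → ¬(u ∈ B ∧ v ∈ B))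

/-- `G` is bipartite: its vertex set can be partitioned into two independent sets
(equivalently, `G` has no odd cycles). -/
def IsBipartite (G : SimpleGraph V) : Prop :=
  ∃ A B : Set V, IsBipartition G A B

/-- `G` is complete bipartite: for some bipartition `(A, B)` of the vertex set, the edges
of `G` are exactly the pairs `{a, b}` with `a ∈ A` and `b ∈ B`. -/
def IsCompleteBipartite (G : SimpleGraph V) : Prop :=
  ∃ A B : Set V, (∀ v, v ∈ A ∨ v ∈ B) ∧ (∀ v, ¬(v ∈ A ∧ v ∈ B)) ∧
    ∀ u v, G.Adj u v ↔ ((u ∈ A ∧ v ∈ B) ∨ (u ∈ B ∧ v ∈ A))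

/-- `G` is chordal: it has no induced cycles of length greater than three, i.e. every
cycle of length at least `4` (an injective cyclic sequence of adjacent vertices) has a
chord (an edge between two vertices that are not consecutive on the cycle). -/
def IsChordal (G : SimpleGraph V) : Prop :=
  ∀ m : ℕ, 4 ≤ m → ∀ f : ZMod m → V, Function.Injective f →
    (∀ i, G.Adj (f i) (f (i + 1))) →
    ∃ i j : ZMod m, i ≠ j ∧ i + 1 ≠ j ∧ j + 1 ≠ i ∧ G.Adj (f i) (f j)

/-- The co-chordal cover number `cochord(G)`: the minimum number of co-chordal subgraphs
of `G` needed to cover the edge set of `G`.  (A graph is co-chordal if its complement is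
chordal; note that a subgraph is co-chordal in this sense iff the complement of the
subgraph on its own vertex set is chordal, since the extra vertices are universal in the
complement and universal vertices do not affect chordality.) -/
noncomputable def cochordalCoverNumber (G : SimpleGraph V) : ℕ :=
  sInf { r | ∃ H : Fin r → SimpleGraph V, (∀ i, H i ≤ G) ∧ (∀ i, IsChordal (H i)ᶜ) ∧
    ∀ e ∈ G.edgeSet, ∃ i, e ∈ (H i).edgeSet }

/-- A criterion for the complement of `H` to be chordal: the vertices of a chordless cycle of
length at least `4` in the complement violate one of the two conditions. -/
theorem isChordal_compl_of_forall {V : Type*} {H : SimpleGraph V}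
    (h4 : ∀ a b c d : V, H.Adj a c → H.Adj b d →
      ¬H.Adj a b → ¬H.Adj b c → ¬H.Adj c d → ¬H.Adj d a → a ≠ b → b ≠ c → c ≠ d → d ≠ a → False)
    (h5 : ∀ a b c d e : V, [a, b, c, d, e].Nodup → H.Adj a c → H.Adj b d → H.Adj c e →
      ¬H.Adj a b → ¬H.Adj b c → ¬H.Adj c d → False) :
    IsChordal Hᶜ := by
  intro m hm f hf hcyc
  by_contra! hch
  have hne : ∀ a b : ℕ, a < m → b < m → a ≠ b → (a : ZMod m) ≠ b := by
    intro a b ha hb hab h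
    rw [ZMod.natCast_eq_natCast_iff', Nat.mod_eq_of_lt ha, Nat.mod_eq_of_lt hb] at h
    exact hab h
  have hsucc : ∀ k : ℕ, ¬H.Adj (f (k : ZMod m)) (f ((k + 1 : ℕ) : ZMod m)) := by
    intro k h
    have := hcyc k
    rw [SimpleGraph.compl_adj] at this
    exact this.2 (by simpa using h)
  have hadj : ∀ a b : ℕ, a + 1 < b → b < m → (b + 1 < m ∨ 0 < a) →
      H.Adj (f (a : ZMod m)) (f (b : ZMod m)) := by
    intro a b hab hb hor
    have h1 : (a : ZMod m) ≠ b := hne a b (by omega) hb (by omega)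
    have h2 : (a : ZMod m) + 1 ≠ b := by
      exact_mod_cast hne (a + 1) b (by omega) hb (by omega)
    have h3 : (b : ZMod m) + 1 ≠ a := by
      by_cases hbm : b + 1 < m
      · exact_mod_cast hne (b + 1) a hbm (by omega) (by omega)
      · have hbm' : b + 1 = m := by omega
        have : ((b + 1 : ℕ) : ZMod m) = ((0 : ℕ) : ZMod m) := by
          rw [hbm']; simp
        have h0 := hne 0 a (by omega) (by omega) (by omega)
        rw [← this] at h0
        exact_mod_cast h0
    have := hch a b h1 h2 h3
    rw [SimpleGraph.compl_adj] at this
    by_contra hn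
    exact this ⟨fun h => h1 (hf h), hn⟩
  have hinj : ∀ a b : ℕ, a < m → b < m → a ≠ b → f (a : ZMod m) ≠ f (b : ZMod m) :=
    fun a b ha hb hab h => hne a b ha hb hab (hf h)
  rcases hm.eq_or_lt with rfl | hm'
  · have h02 : H.Adj (f ((0 : ℕ) : ZMod 4)) (f ((2 : ℕ) : ZMod 4)) :=
      hadj 0 2 (by omega) (by omega) (by omega)
    refine h4 _ _ _ _ h02 (hadj 1 3 (by omega) (by omega) (by omega))
      (hsucc 0) (hsucc 1) (hsucc 2) (hsucc 3) ?_ ?_ ?_ ?_ <;>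
      exact hinj _ _ (by omega) (by omega) (by omega)
  · refine h5 (f ((0 : ℕ) : ZMod m)) (f ((1 : ℕ) : ZMod m)) (f ((2 : ℕ) : ZMod m))
      (f ((3 : ℕ) : ZMod m)) (f ((4 : ℕ) : ZMod m)) ?_ (hadj 0 2 (by omega) (by omega) (by omega))
      (hadj 1 3 (by omega) (by omega) (by omega)) (hadj 2 4 (by omega) (by omega) (by omega))
      (hsucc 0) (hsucc 1) (hsucc 2)
    simp only [List.nodup_cons, List.mem_cons, List.not_mem_nil, or_false, not_or,
      not_false_eq_true, List.nodup_nil, and_true]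
    refine ⟨⟨?_, ?_, ?_, ?_⟩, ⟨?_, ?_, ?_⟩, ⟨?_, ?_⟩, ?_⟩ <;>
      exact hinj _ _ (by omega) (by omega) (by omega)

/-- The subgraph of `G` formed by the edges that meet `e`. -/
def edgeStar {V : Type*} (G : SimpleGraph V) (e : Sym2 V) : SimpleGraph V where
  Adj x y := G.Adj x y ∧ (x ∈ e ∨ y ∈ e)
  symm := ⟨fun _ _ h => ⟨h.1.symm, h.2.symm⟩⟩
  loopless := ⟨fun _ h => h.1.ne rfl⟩

/-- The subgraph of `G` formed by the edges with both endpoints on `e` or `f`. -/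
def edgePairSpan {V : Type*} (G : SimpleGraph V) (e f : Sym2 V) : SimpleGraph V where
  Adj x y := G.Adj x y ∧ (x ∈ e ∨ x ∈ f) ∧ (y ∈ e ∨ y ∈ f)
  symm := ⟨fun _ _ h => ⟨h.1.symm, h.2.2, h.2.1⟩⟩
  loopless := ⟨fun _ h => h.1.ne rfl⟩

theorem isChordal_compl_edgeStar {V : Type*} {G : SimpleGraph V} {e : Sym2 V}
    (he : e ∈ G.edgeSet) : IsChordal (edgeStar G e)ᶜ := by
  induction e with | _ u v
  rw [SimpleGraph.mem_edgeSet] at he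
  have huv : (edgeStar G s(u, v)).Adj u v := ⟨he, by simp⟩
  have hmeet : ∀ x y, (edgeStar G s(u, v)).Adj x y → x = u ∨ x = v ∨ y = u ∨ y = v := by
    intro x y h
    simpa [or_assoc] using h.2
  have hvu := huv.symm
  have hneuv := huv.ne
  generalize edgeStar G s(u, v) = H at *
  apply isChordal_compl_of_forall
  · intro a b c d hac hbd
    have h1 := hmeet _ _ hac
    have h2 := hmeet _ _ hbd
    have := hac.ne
    have := hbd.ne
    grind [SimpleGraph.adj_comm]
  · intro a b c d e hnd hac hbd hce
    have h1 := hmeet _ _ hac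
    have h2 := hmeet _ _ hbd
    have h3 := hmeet _ _ hce
    simp only [List.nodup_cons, List.mem_cons, List.not_mem_nil, or_false, not_or,
      not_false_eq_true, List.nodup_nil, and_true] at hnd
    grind [SimpleGraph.adj_comm]

theorem isChordal_compl_edgePairSpan {V : Type*} {G : SimpleGraph V} {e f : Sym2 V}
    (he : e ∈ G.edgeSet) (hf : f ∈ G.edgeSet) (hdisj : ∀ v ∈ e, v ∉ f)
    {x y : V} (hx : x ∈ e) (hy : y ∈ f) (hxy : G.Adj x y) :
    IsChordal (edgePairSpan G e f)ᶜ := by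
  obtain ⟨x', rfl⟩ := hx
  obtain ⟨y', rfl⟩ := hy
  rw [SimpleGraph.mem_edgeSet] at he hf
  have h1 : (edgePairSpan G s(x, x') s(y, y')).Adj x x' := ⟨he, by simp, by simp⟩
  have h2 : (edgePairSpan G s(x, x') s(y, y')).Adj y y' := ⟨hf, by simp, by simp⟩
  have h3 : (edgePairSpan G s(x, x') s(y, y')).Adj x y := ⟨hxy, by simp, by simp⟩
  have hmem : ∀ p q, (edgePairSpan G s(x, x') s(y, y')).Adj p q →
      p = x ∨ p = x' ∨ p = y ∨ p = y' := by
    intro p q h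
    simpa [or_assoc] using h.2.1
  have hx'y : x' ≠ y := by rintro rfl; exact hdisj x' (by simp) (by simp)
  generalize edgePairSpan G s(x, x') s(y, y') = H at *
  apply isChordal_compl_of_forall
  · intro a b c d hac hbd hab hbc hcd hda _ _ _ _
    have ha := hmem _ _ hac
    have hb := hmem _ _ hbd
    have hc := hmem _ _ hac.symm
    have hd := hmem _ _ hbd.symm
    have := hac.ne
    have := hbd.ne
    have hxm : x = a ∨ x = b ∨ x = c ∨ x = d := by grind
    have hym : y = a ∨ y = b ∨ y = c ∨ y = d := by grind
    have hx'm : x' = a ∨ x' = b ∨ x' = c ∨ x' = d := by grind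
    have := h1.ne
    have := h3.ne
    grind [SimpleGraph.adj_comm]
  · intro a b c d e hnd hac hbd hce
    have ha := hmem _ _ hac
    have hb := hmem _ _ hbd
    have hc := hmem _ _ hac.symm
    have hd := hmem _ _ hbd.symm
    have he := hmem _ _ hce.symm
    simp only [List.nodup_cons, List.mem_cons, List.not_mem_nil, or_false, not_or,
      not_false_eq_true, List.nodup_nil, and_true] at hnd
    grind

theorem exists_isMatchingFinset_card_eq_matchingNumber {V : Type*} [Finite V]
    (G : SimpleGraph V) :
    ∃ M : Finset (Sym2 V), IsMatchingFinset G M ∧ M.card = matchingNumber G := by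
  classical
  have := Fintype.ofFinite V
  refine Nat.sSup_mem (s := { m | ∃ M : Finset (Sym2 V), IsMatchingFinset G M ∧ M.card = m })
    ⟨0, ∅, by simp [IsMatchingFinset], rfl⟩ ⟨Fintype.card (Sym2 V), ?_⟩
  rintro m ⟨M, -, rfl⟩
  exact M.card_le_univ

/-- A matching with `|V| / 2` edges covers every vertex. -/
theorem IsMatchingFinset.exists_mem_of_two_mul_card_eq {V : Type*} [Fintype V]
    {G : SimpleGraph V} {M : Finset (Sym2 V)} (hM : IsMatchingFinset G M)
    (hcard : 2 * M.card = Fintype.card V) (v : V) : ∃ e ∈ M, v ∈ e := by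
  classical
  have hU : (M.biUnion Sym2.toFinset).card = Fintype.card V := by
    rw [Finset.card_biUnion]
    · rw [Finset.sum_congr rfl fun e he =>
        Sym2.card_toFinset_of_not_isDiag e (G.not_isDiag_of_mem_edgeSet (hM.1 e he))]
      simp [← hcard, mul_comm]
    · intro e he f hf hef
      change Disjoint e.toFinset f.toFinset
      rw [Finset.disjoint_left]
      intro w hw
      simpa using hM.2 e he f hf hef w (by simpa using hw)
  have hv : v ∈ M.biUnion Sym2.toFinset := by
    rw [Finset.eq_univ_of_card _ hU]
    exact Finset.mem_univ v
  simpa using hv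

theorem cochordalCoverNumber_le_card {V ι : Type*} [Fintype ι] {G : SimpleGraph V}
    (H : ι → SimpleGraph V) (hle : ∀ i, H i ≤ G) (hch : ∀ i, IsChordal (H i)ᶜ)
    (hcov : ∀ x y, G.Adj x y → ∃ i, (H i).Adj x y) :
    cochordalCoverNumber G ≤ Fintype.card ι := by
  refine Nat.sInf_le ⟨H ∘ (Fintype.equivFin ι).symm, fun i => hle _, fun i => hch _, ?_⟩
  intro e he
  induction e with | _ x y
  obtain ⟨i, hi⟩ := hcov x y he
  exact ⟨Fintype.equivFin ι i, by simpa using hi⟩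

theorem SimpleGraph.Connected.exists_adj_mem_notMem {V : Type*} {G : SimpleGraph V}
    (hG : G.Connected) {S : Set V} {u v : V} (hu : u ∈ S) (hv : v ∉ S) :
    ∃ x y, x ∈ S ∧ y ∉ S ∧ G.Adj x y := by
  obtain ⟨p⟩ := hG.preconnected u v
  obtain ⟨d, -, h1, h2⟩ := p.exists_boundary_dart S hu hv
  exact ⟨d.fst, d.snd, h1, h2, d.adj⟩

/-- Let `G` be a connected graph on `n ≥ 4` vertices, `n` even. If the matching number of
`G` is `n/2`, then the co-chordal cover number of `G` is strictly less than `n/2`. -/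
theorem cochordalCoverNumber_lt_of_matchingNumber_eq {n : ℕ} (hn : 4 ≤ n) (hev : Even n)
    (G : SimpleGraph (Fin n)) (hconn : G.Connected) (hmat : matchingNumber G = n / 2) :
    cochordalCoverNumber G < n / 2 := by
  classical
  obtain ⟨M, hM, hMcard⟩ := exists_isMatchingFinset_card_eq_matchingNumber G
  rw [hmat] at hMcard
  have hcover := hM.exists_mem_of_two_mul_card_eq
    (by rw [hMcard, Fintype.card_fin, Nat.two_mul_div_two_of_even hev])
  obtain ⟨e, he, e', he', hee'⟩ := Finset.one_lt_card.mp (by omega : 1 < M.card)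
  obtain ⟨x, y, hx, hy, hxy⟩ := hconn.exists_adj_mem_notMem (S := {v | v ∈ e})
    (e.out_fst_mem) (hM.2 e' he' e he hee'.symm _ e'.out_fst_mem)
  obtain ⟨f, hf, hyf⟩ := hcover y
  have hef : e ≠ f := by
    rintro rfl
    exact hy hyf
  let H : M.erase e → SimpleGraph (Fin n) := fun g =>
    if (g : Sym2 (Fin n)) = f then edgePairSpan G e f else edgeStar G g
  have hle : cochordalCoverNumber G ≤ Fintype.card (M.erase e) := by
    refine cochordalCoverNumber_le_card H ?_ ?_ ?_
    · intro g p q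
      simp only [H]
      split_ifs
      · exact fun h => h.1
      · exact fun h => h.1
    · intro g
      simp only [H]
      split_ifs
      · exact isChordal_compl_edgePairSpan (hM.1 e he) (hM.1 f hf) (hM.2 e he f hf hef)
          hx hyf hxy
      · exact isChordal_compl_edgeStar (hM.1 g (Finset.mem_of_mem_erase g.2))
    · intro p q hpq
      by_cases hstar : ∃ g ∈ M, g ≠ e ∧ g ≠ f ∧ (p ∈ g ∨ q ∈ g)
      · obtain ⟨g, hg, hge, hgf, hmem⟩ := hstar
        refine ⟨⟨g, Finset.mem_erase.mpr ⟨hge, hg⟩⟩, ?_⟩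
        simp only [H, if_neg hgf]
        exact ⟨hpq, hmem⟩
      · refine ⟨⟨f, Finset.mem_erase.mpr ⟨hef.symm, hf⟩⟩, ?_⟩
        simp only [H, if_true]
        obtain ⟨g, hg, hpg⟩ := hcover p
        obtain ⟨k, hk, hqk⟩ := hcover q
        refine ⟨hpq, ?_, ?_⟩ <;> grind
  rw [Fintype.card_coe, Finset.card_erase_of_mem he] at hle
  omega
end

section
/- Let G be a connected bipartite finite simple graph on n = 2k+1 vertices with k ≥ 1, whose induced matching number equals k. Then G is a tree and the maximum cardinality of a minimal vertex cover of G equals k+1. -/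
variable {V : Type*}

/-- `G` is the star with centre `w` and leaves `a i`, with a pendant edge `a i - b i` attached
at each of the `a i`. -/
structure IsSubdividedStar {ι V : Type*} (G : SimpleGraph V) (w : V) (a b : ι → V) : Prop where
  exhaust : ∀ v, v = w ∨ ∃ i, v = a i ∨ v = b i
  b_injective : Function.Injective b
  a_ne_b : ∀ i j, a i ≠ b j
  b_ne_w : ∀ i, b i ≠ w
  mem_edgeSet : ∀ e, e ∈ G.edgeSet ↔ ∃ i, e = s(w, a i) ∨ e = s(a i, b i)

namespace IsSubdividedStar

variable {ι V : Type*} {G : SimpleGraph V} {w : V} {a b : ι → V}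

theorem card_edgeSet_le [Fintype ι] (h : IsSubdividedStar G w a b) :
    Nat.card G.edgeSet ≤ 2 * Fintype.card ι := by
  classical
  have hsub : G.edgeSet ⊆ (((Finset.univ.image fun i => s(w, a i)) ∪
      Finset.univ.image fun i => s(a i, b i) : Finset (Sym2 V)) : Set (Sym2 V)) := by
    intro e he
    obtain ⟨i, rfl | rfl⟩ := (h.mem_edgeSet e).1 he
    · exact Finset.mem_coe.2 (Finset.mem_union_left _ (Finset.mem_image_of_mem _ (by simp)))
    · exact Finset.mem_coe.2 (Finset.mem_union_right _
        (Finset.mem_image_of_mem (fun i => s(a i, b i)) (by simp)))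
  calc Nat.card G.edgeSet
      ≤ _ := Set.ncard_le_ncard hsub (Finset.finite_toSet _)
    _ ≤ _ := by rw [Set.ncard_coe_finset]; exact Finset.card_union_le _ _
    _ ≤ Fintype.card ι + Fintype.card ι := add_le_add Finset.card_image_le Finset.card_image_le
    _ = 2 * Fintype.card ι := (two_mul _).symm

theorem card_le_of_isMinimalVertexCover [Fintype ι] (h : IsSubdividedStar G w a b)
    {C : Finset V} (hC : IsMinimalVertexCover G C) : C.card ≤ Fintype.card ι + 1 := by
  classical
  have hnot : ∀ i, a i ∈ C → b i ∉ C := by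
    intro i ha hb
    refine hC.2 _ (Finset.erase_ssubset hb) fun e he => ?_
    obtain ⟨j, rfl | rfl⟩ := (h.mem_edgeSet e).1 he
    · obtain ⟨v, hv, hve⟩ := hC.1 _ he
      refine ⟨v, Finset.mem_erase.2 ⟨?_, hv⟩, hve⟩
      rintro rfl
      rcases Sym2.mem_iff.1 hve with h' | h'
      · exact h.b_ne_w i h'
      · exact h.a_ne_b j i h'.symm
    · by_cases hij : b j = b i
      · obtain rfl := h.b_injective hij
        exact ⟨a j, Finset.mem_erase.2 ⟨h.a_ne_b j j, ha⟩, Sym2.mem_mk_left _ _⟩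
      · obtain ⟨v, hv, hve⟩ := hC.1 _ he
        refine ⟨v, Finset.mem_erase.2 ⟨?_, hv⟩, hve⟩
        rintro rfl
        rcases Sym2.mem_iff.1 hve with h' | h'
        · exact h.a_ne_b j i h'.symm
        · exact hij h'.symm
  have hsub : C ⊆ insert w (Finset.univ.image fun i => if a i ∈ C then a i else b i) := by
    intro v hv
    obtain rfl | ⟨i, rfl | rfl⟩ := h.exhaust v
    · simp
    · exact Finset.mem_insert_of_mem (Finset.mem_image.2 ⟨i, by simp, by simp [hv]⟩)
    · refine Finset.mem_insert_of_mem (Finset.mem_image.2 ⟨i, by simp, ?_⟩)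
      rw [if_neg fun ha => hnot i ha hv]
  exact (Finset.card_le_card hsub).trans ((Finset.card_insert_le _ _).trans
    (Nat.add_le_add_right Finset.card_image_le 1))

theorem exists_isMinimalVertexCover [Fintype ι] [Nonempty ι] (h : IsSubdividedStar G w a b)
    (ha : ∀ i, a i ≠ w) :
    ∃ C : Finset V, IsMinimalVertexCover G C ∧ C.card = Fintype.card ι + 1 := by
  classical
  refine ⟨insert w (Finset.univ.image b), ⟨fun e he => ?_, fun D hD hcov => ?_⟩, ?_⟩
  · obtain ⟨i, rfl | rfl⟩ := (h.mem_edgeSet e).1 he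
    · exact ⟨w, by simp, by simp⟩
    · exact ⟨b i, by simp, by simp⟩
  · have haD : ∀ i, a i ∉ D := by
      intro i hi
      rcases Finset.mem_insert.1 (hD.1 hi) with h' | h'
      · exact ha i h'
      · obtain ⟨j, -, hj⟩ := Finset.mem_image.1 h'
        exact h.a_ne_b i j hj.symm
    refine hD.2 fun v hv => ?_
    rcases Finset.mem_insert.1 hv with rfl | hv
    · obtain ⟨i⟩ := ‹Nonempty ι›
      obtain ⟨u, hu, hue⟩ := hcov _ ((h.mem_edgeSet s(v, a i)).2 ⟨i, Or.inl rfl⟩)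
      rcases Sym2.mem_iff.1 hue with rfl | rfl
      · exact hu
      · exact absurd hu (haD i)
    · obtain ⟨i, -, rfl⟩ := Finset.mem_image.1 hv
      obtain ⟨u, hu, hue⟩ := hcov _ ((h.mem_edgeSet s(a i, b i)).2 ⟨i, Or.inr rfl⟩)
      rcases Sym2.mem_iff.1 hue with rfl | rfl
      · exact absurd hu (haD i)
      · exact hu
  · rw [Finset.card_insert_of_notMem (by simpa using h.b_ne_w),
      Finset.card_image_of_injective _ h.b_injective, Finset.card_univ]

theorem tauMax_eq [Fintype ι] [Nonempty ι] (h : IsSubdividedStar G w a b) :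
    tauMax G = Fintype.card ι + 1 := by
  have ha : ∀ i, a i ≠ w := fun i hi =>
    G.loopless.irrefl w (by simpa [hi] using (h.mem_edgeSet s(w, a i)).2 ⟨i, Or.inl rfl⟩)
  refine IsGreatest.csSup_eq ⟨h.exists_isMinimalVertexCover ha, ?_⟩
  rintro _ ⟨C, hC, rfl⟩
  exact h.card_le_of_isMinimalVertexCover hC

end IsSubdividedStar

theorem IsMatchingFinset.card_biUnion_toFinset {V : Type*} [DecidableEq V] {G : SimpleGraph V}
    {M : Finset (Sym2 V)} (hM : IsMatchingFinset G M) :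
    (M.biUnion Sym2.toFinset).card = 2 * M.card := by
  rw [Finset.card_biUnion, Finset.sum_congr rfl fun e he =>
    Sym2.card_toFinset_of_not_isDiag e (G.not_isDiag_of_mem_edgeSet (hM.1 e he))]
  · simp [mul_comm]
  · intro e he f hf hef
    refine Finset.disjoint_left.2 fun v hve hvf => ?_
    exact hM.2 e he f hf hef v (Sym2.mem_toFinset.1 hve) (Sym2.mem_toFinset.1 hvf)

theorem IsMatchingFinset.existsUnique_forall_notMem {V : Type*} [Fintype V] {G : SimpleGraph V}
    {M : Finset (Sym2 V)} (hM : IsMatchingFinset G M) (hV : Fintype.card V = 2 * M.card + 1) :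
    ∃! w, ∀ e ∈ M, w ∉ e := by
  classical
  have hcard : (M.biUnion Sym2.toFinset)ᶜ.card = 1 := by
    rw [Finset.card_compl, hM.card_biUnion_toFinset, hV]
    omega
  obtain ⟨w, hw⟩ := Finset.card_eq_one.1 hcard
  have hiff : ∀ v, (∀ e ∈ M, v ∉ e) ↔ v = w := by
    intro v
    simpa using Finset.ext_iff.1 hw v
  exact ⟨w, (hiff w).2 rfl, fun v hv => (hiff v).1 hv⟩

theorem exists_isInducedMatchingFinset_card_eq {V : Type*} [Finite V] (G : SimpleGraph V) :
    ∃ M : Finset (Sym2 V), IsInducedMatchingFinset G M ∧ M.card = inducedMatchingNumber G := by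
  classical
  have := Fintype.ofFinite V
  refine Nat.sSup_mem (s := {m | ∃ M : Finset (Sym2 V), IsInducedMatchingFinset G M ∧ M.card = m})
    ⟨0, ∅, ⟨⟨by simp, by simp⟩, fun e he h => ?_⟩, rfl⟩ ⟨Fintype.card (Sym2 V), ?_⟩
  · induction e with
    | _ x y => simpa using h x (Sym2.mem_mk_left x y)
  · rintro _ ⟨M, -, rfl⟩
    exact Finset.card_le_univ M

/-- In a connected graph, an edge of an induced matching avoiding a single vertex `w` has an
endpoint adjacent to `w`. -/
theorem IsInducedMatchingFinset.exists_mem_adj {V : Type*} {G : SimpleGraph V}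
    {M : Finset (Sym2 V)} (hM : IsInducedMatchingFinset G M) (hG : G.Connected) {w : V}
    (hw : ∀ v, v ≠ w → ∃ e ∈ M, v ∈ e) {e : Sym2 V} (he : e ∈ M) (hwe : w ∉ e) :
    ∃ v ∈ e, G.Adj w v := by
  obtain ⟨x, hx⟩ : ∃ x, x ∈ e := ⟨_, e.out_fst_mem⟩
  obtain ⟨p⟩ := hG.preconnected x w
  obtain ⟨d, -, hd₁, hd₂⟩ := p.exists_boundary_dart {v | v ∈ e} hx hwe
  refine ⟨d.fst, hd₁, ?_⟩
  by_cases hdw : d.snd = w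
  · rw [← hdw]
    exact d.adj.symm
  obtain ⟨f, hf, hdf⟩ := hw _ hdw
  have hmem : s(d.fst, d.snd) ∈ M := by
    refine hM.2 _ d.adj fun v hv => ?_
    rcases Sym2.mem_iff.1 hv with rfl | rfl
    exacts [⟨e, he, hd₁⟩, ⟨f, hf, hdf⟩]
  by_cases heq : e = s(d.fst, d.snd)
  · exact absurd (heq ▸ Sym2.mem_mk_right _ _) hd₂
  · exact absurd (Sym2.mem_mk_left _ _) (hM.1.2 e he _ hmem heq _ hd₁)

theorem IsBipartite.not_adj_of_adj_of_adj {V : Type*} {G : SimpleGraph V} (hG : IsBipartite G)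
    {x y z : V} (hxy : G.Adj x y) (hyz : G.Adj y z) : ¬ G.Adj x z := by
  obtain ⟨A, B, hcov, -, hA, hB⟩ := hG
  intro hxz
  have h₁ := hA _ _ hxy
  have h₂ := hA _ _ hyz
  have h₃ := hA _ _ hxz
  have h₄ := hB _ _ hxy
  have h₅ := hB _ _ hyz
  have h₆ := hB _ _ hxz
  have := hcov x
  have := hcov y
  have := hcov z
  tauto

theorem IsInducedMatchingFinset.exists_isSubdividedStar {V : Type*} [Fintype V]
    {G : SimpleGraph V} {M : Finset (Sym2 V)} (hM : IsInducedMatchingFinset G M)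
    (hV : Fintype.card V = 2 * M.card + 1) (hconn : G.Connected) (hbip : IsBipartite G) :
    ∃ (w : V) (a b : M → V), IsSubdividedStar G w a b := by
  obtain ⟨w, hwM, hw⟩ := hM.1.existsUnique_forall_notMem hV
  have hcov : ∀ v, v ≠ w → ∃ e ∈ M, v ∈ e := by
    intro v hv
    by_contra! h
    exact hv (hw v h)
  have hends : ∀ e : M, ∃ x y, (e : Sym2 V) = s(x, y) ∧ G.Adj w x := by
    intro e
    obtain ⟨x, hx, hwx⟩ := hM.exists_mem_adj hconn hcov e.2 (hwM e e.2)
    obtain ⟨y, hy⟩ := hx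
    exact ⟨x, y, hy, hwx⟩
  choose a b hab hwa using hends
  have hae : ∀ e : M, a e ∈ (e : Sym2 V) := fun e => by rw [hab e]; exact Sym2.mem_mk_left _ _
  have hbe : ∀ e : M, b e ∈ (e : Sym2 V) := fun e => by rw [hab e]; exact Sym2.mem_mk_right _ _
  have hadj : ∀ e : M, G.Adj (a e) (b e) := by
    intro e
    rw [← SimpleGraph.mem_edgeSet, ← hab e]
    exact hM.1.1 e e.2
  have hwb : ∀ e : M, ¬ G.Adj w (b e) := fun e => hbip.not_adj_of_adj_of_adj (hwa e) (hadj e)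
  have hcenter : ∀ v, G.Adj w v → ∃ i, v = a i := by
    intro v hv
    obtain ⟨e, he, hve⟩ := hcov v hv.ne'
    have hve' : v ∈ s(a ⟨e, he⟩, b ⟨e, he⟩) := hab ⟨e, he⟩ ▸ hve
    rcases Sym2.mem_iff.1 hve' with h | rfl
    exacts [⟨_, h⟩, absurd hv (hwb _)]
  refine ⟨w, a, b, fun v => ?_, fun e f hef => ?_, fun e f hef => ?_, fun e h => ?_, fun e => ?_⟩
  · by_cases hv : v = w
    · exact Or.inl hv
    · obtain ⟨e, he, hve⟩ := hcov v hv
      have hve' : v ∈ s(a ⟨e, he⟩, b ⟨e, he⟩) := hab ⟨e, he⟩ ▸ hve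
      exact Or.inr ⟨⟨e, he⟩, Sym2.mem_iff.1 hve'⟩
  · by_contra hne
    exact hM.1.2 e e.2 f f.2 (Subtype.coe_ne_coe.2 hne) (b e) (hbe e) (hef ▸ hbe f)
  · exact hwb f (hef ▸ hwa e)
  · exact hwM e e.2 (h ▸ hbe e)
  · constructor
    · induction e with
      | _ x y =>
        intro he
        rw [SimpleGraph.mem_edgeSet] at he
        by_cases hx : x = w
        · subst hx
          obtain ⟨i, rfl⟩ := hcenter y he
          exact ⟨i, Or.inl rfl⟩
        by_cases hy : y = w
        · subst hy
          obtain ⟨i, rfl⟩ := hcenter x he.symm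
          exact ⟨i, Or.inl Sym2.eq_swap⟩
        have hmem : s(x, y) ∈ M := by
          refine hM.2 _ he fun v hv => ?_
          rcases Sym2.mem_iff.1 hv with rfl | rfl
          exacts [hcov _ hx, hcov _ hy]
        exact ⟨⟨_, hmem⟩, Or.inr (hab ⟨_, hmem⟩)⟩
    · rintro ⟨i, rfl | rfl⟩
      exacts [hwa i, hadj i]

/-- Let `G` be a connected bipartite graph on `n = 2k + 1` vertices with `k ≥ 1` whose
induced matching number equals `k`. Then `G` is a tree and `τ_max(G) = k + 1`. -/
theorem isTree_and_tauMax_of_inducedMatchingNumber (k : ℕ) (hk : 1 ≤ k)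
    (G : SimpleGraph (Fin (2 * k + 1))) (hconn : G.Connected) (hbip : IsBipartite G)
    (him : inducedMatchingNumber G = k) :
    G.IsTree ∧ tauMax G = k + 1 := by
  obtain ⟨M, hM, hcard⟩ := exists_isInducedMatchingFinset_card_eq G
  rw [him] at hcard
  obtain ⟨w, a, b, hstar⟩ := hM.exists_isSubdividedStar (by simp [hcard]) hconn hbip
  have hι : Fintype.card M = k := by rw [Fintype.card_coe, hcard]
  have : Nonempty M := Fintype.card_pos_iff.1 (by omega)
  refine ⟨SimpleGraph.isTree_iff_connected_and_card.2 ⟨hconn, ?_⟩, by rw [hstar.tauMax_eq, hι]⟩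
  have hle := hstar.card_edgeSet_le
  have hge := hconn.card_vert_le_card_edgeSet_add_one
  rw [hι] at hle
  rw [Nat.card_fin] at hge ⊢
  omega
end

section
/- If G is a connected bipartite finite simple graph on n ≥ 2 vertices that is not complete bipartite, then the independence complex of G is a connected simplicial complex. -/
variable {V : Type*}

/-- `A` is an independent set of `G`. -/
def IsIndepSet (G : SimpleGraph V) (A : Set V) : Prop :=
  ∀ u ∈ A, ∀ v ∈ A, ¬ G.Adj u v

/-- `A` is a facet (maximal face) of the independence complex of `G`, i.e. a maximal
independent set of `G`. -/
def IsIndepFacet (G : SimpleGraph V) (A : Set V) : Prop :=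
  IsIndepSet G A ∧ ∀ B : Set V, A ⊆ B → IsIndepSet G B → B = A

/-- In a finite graph, every independent set is contained in a facet. -/
theorem IsIndepSet.exists_subset_isIndepFacet [Finite V] {G : SimpleGraph V} {S : Set V}
    (hS : IsIndepSet G S) : ∃ F, S ⊆ F ∧ IsIndepFacet G F := by
  obtain ⟨F, hSF, hF⟩ := Finite.exists_le_maximal (p := IsIndepSet G) hS
  exact ⟨F, hSF, hF.prop, fun B hFB hB => (hF.le_of_ge hB hFB).antisymm hFB⟩

/-- Facets of the independence complex of a nonempty graph are nonempty. -/
theorem IsIndepFacet.nonempty [Nonempty V] {G : SimpleGraph V} {A : Set V}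
    (hA : IsIndepFacet G A) : A.Nonempty := by
  obtain ⟨v⟩ := ‹Nonempty V›
  by_contra h
  rw [Set.not_nonempty_iff_eq_empty] at h
  have hv : IsIndepSet G {v} := by
    rintro _ rfl _ rfl
    exact G.irrefl
  exact Set.singleton_ne_empty v ((hA.2 {v} (by simp [h]) hv).trans h)

/-- A bipartite graph that is not complete bipartite has a non-adjacent pair of vertices in
opposite parts. -/
theorem IsBipartition.exists_not_adj {G : SimpleGraph V} {P Q : Set V}
    (h : IsBipartition G P Q) (hncb : ¬ IsCompleteBipartite G) :
    ∃ p ∈ P, ∃ q ∈ Q, ¬ G.Adj p q := by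
  obtain ⟨hcover, hdisj, hP, hQ⟩ := h
  by_contra! hadj
  refine hncb ⟨P, Q, hcover, hdisj, fun u v => ⟨fun huv => ?_, ?_⟩⟩
  · have := hP u v huv
    have := hQ u v huv
    have := hcover u
    have := hcover v
    tauto
  · rintro (⟨hu, hv⟩ | ⟨hu, hv⟩)
    · exact hadj u hu v hv
    · exact (hadj v hv u hu).symm

/-- If `G` is a connected bipartite graph on `n ≥ 2` vertices which is not complete
bipartite, then the independence complex of `G` is connected: any two facets can be
joined by a chain of facets in which consecutive facets intersect nontrivially. -/
theorem independenceComplex_connected_of_not_completeBipartite {n : ℕ} (hn : 2 ≤ n)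
    (G : SimpleGraph (Fin n)) (hconn : G.Connected) (hbip : IsBipartite G)
    (hncb : ¬ IsCompleteBipartite G) :
    ∀ A B : Set (Fin n), IsIndepFacet G A → IsIndepFacet G B →
      Relation.ReflTransGen
        (fun X Y : Set (Fin n) =>
          IsIndepFacet G X ∧ IsIndepFacet G Y ∧ (X ∩ Y).Nonempty) A B := by
  intro A B hA hB
  obtain ⟨P, Q, hPQ⟩ := hbip
  obtain ⟨p, hp, q, hq, hpq⟩ := hPQ.exists_not_adj hncb
  obtain ⟨hcover, -, hP, hQ⟩ := hPQ
  have : Nonempty (Fin n) := ⟨p⟩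
  have hpair : IsIndepSet G {p, q} := by
    rintro u (rfl | rfl) v (rfl | rfl)
    exacts [G.irrefl, hpq, fun h => hpq h.symm, G.irrefl]
  obtain ⟨E, hPE, hE⟩ := IsIndepSet.exists_subset_isIndepFacet (G := G) (S := P)
    fun u hu v hv huv => hP u v huv ⟨hu, hv⟩
  obtain ⟨F, hQF, hF⟩ := IsIndepSet.exists_subset_isIndepFacet (G := G) (S := Q)
    fun u hu v hv huv => hQ u v huv ⟨hu, hv⟩
  obtain ⟨C, hpqC, hC⟩ := hpair.exists_subset_isIndepFacet
  have hpC : p ∈ C := hpqC (by simp)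
  have hqC : q ∈ C := hpqC (by simp)
  have key : ∀ X, IsIndepFacet G X → ∃ D, IsIndepFacet G D ∧ (X ∩ D).Nonempty ∧
      (D ∩ C).Nonempty := by
    intro X hX
    obtain ⟨x, hx⟩ := hX.nonempty
    rcases hcover x with hxP | hxQ
    · exact ⟨E, hE, ⟨x, hx, hPE hxP⟩, ⟨p, hPE hp, hpC⟩⟩
    · exact ⟨F, hF, ⟨x, hx, hQF hxQ⟩, ⟨q, hQF hq, hqC⟩⟩
  obtain ⟨D, hD, hAD, hDC⟩ := key A hA
  obtain ⟨D', hD', hBD, hDC'⟩ := key B hB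
  rw [Set.inter_comm] at hBD hDC'
  exact .head ⟨hA, hD, hAD⟩ <| .head ⟨hD, hC, hDC⟩ <| .head ⟨hC, hD', hDC'⟩ <|
    .single ⟨hD', hB, hBD⟩
end

section
/- Let G be a tree on n vertices with induced matching number r and with maximum cardinality of a minimal vertex cover equal to p. Then p ≤ n − r. -/
variable {V : Type*}

/-- In a tree rooted at `ρ`, a vertex has at most one neighbour closer to the root. -/
theorem SimpleGraph.IsTree.eq_of_adj_of_dist_lt {G : SimpleGraph V} (hG : G.IsTree) {ρ u v w : V}
    (hu : G.Adj u w) (hv : G.Adj v w) (hdu : G.dist ρ u < G.dist ρ w)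
    (hdv : G.dist ρ v < G.dist ρ w) : u = v := by
  classical
  have notMem_support {x : V} {p : G.Walk ρ x} (hp : p.length = G.dist ρ x)
      (hx : G.dist ρ x < G.dist ρ w) : w ∉ p.support := fun h => by
    have h₁ := G.dist_le (p.takeUntil w h)
    have h₂ := p.length_takeUntil_le_length h
    omega
  obtain ⟨p, hp, hpl⟩ := hG.connected.exists_path_of_dist ρ u
  obtain ⟨q, hq, hql⟩ := hG.connected.exists_path_of_dist ρ v
  have hpw := hp.concat (notMem_support hpl hdu) hu
  have hqw := hq.concat (notMem_support hql hdv) hv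
  have h := congrArg Subtype.val ((hG.isAcyclic.subsingleton_path ρ w).elim ⟨_, hpw⟩ ⟨_, hqw⟩)
  exact (SimpleGraph.Walk.concat_inj h).1

/-- Every vertex of a minimal vertex cover has a neighbour outside of it. -/
theorem IsMinimalVertexCover.exists_adj_notMem {G : SimpleGraph V} {C : Finset V}
    (hC : IsMinimalVertexCover G C) {v : V} (hv : v ∈ C) : ∃ w, G.Adj v w ∧ w ∉ C := by
  classical
  have h := hC.2 _ (Finset.erase_ssubset hv)
  simp only [IsVertexCover, not_forall, not_exists, not_and] at h
  obtain ⟨e, he, h⟩ := h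
  obtain ⟨x, hx, hxe⟩ := hC.1 e he
  obtain rfl : x = v := by
    by_contra hne
    exact h x (Finset.mem_erase.2 ⟨hne, hx⟩) hxe
  obtain ⟨w, rfl⟩ := Sym2.mem_iff_exists.1 hxe
  have hxw : G.Adj x w := he
  exact ⟨w, hxw, fun hw => h w (Finset.mem_erase.2 ⟨hxw.ne', hw⟩) (Sym2.mem_mk_right x w)⟩

/-- In a tree, a dominating set has at least as many elements as any induced matching. -/
theorem IsInducedMatchingFinset.card_le_of_dominating {G : SimpleGraph V} (hG : G.IsTree)
    {M : Finset (Sym2 V)} (hM : IsInducedMatchingFinset G M) {D : Finset V}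
    (hD : ∀ v, v ∈ D ∨ ∃ w ∈ D, G.Adj v w) : M.card ≤ D.card := by
  obtain ⟨ρ⟩ := hG.connected.nonempty
  have hdom : ∀ e ∈ M, ∃ d ∈ D, d ∈ e ∨ ∃ v ∈ e, G.Adj v d ∧ G.dist ρ v < G.dist ρ d := by
    have aux {u v : V} (huv : G.Adj u v) (hlt : G.dist ρ u < G.dist ρ v) :
        ∃ d ∈ D, d ∈ s(u, v) ∨ ∃ x ∈ s(u, v), G.Adj x d ∧ G.dist ρ x < G.dist ρ d := by
      obtain hv | ⟨d, hd, hvd⟩ := hD v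
      · exact ⟨v, hv, Or.inl (Sym2.mem_mk_right u v)⟩
      · refine ⟨d, hd, ?_⟩
        rcases lt_or_gt_of_ne (hG.dist_ne_of_adj ρ hvd) with h | h
        · exact Or.inr ⟨v, Sym2.mem_mk_right u v, hvd, h⟩
        · obtain rfl := hG.eq_of_adj_of_dist_lt huv hvd.symm hlt h
          exact Or.inl (Sym2.mem_mk_left u v)
    intro e he
    induction e using Sym2.ind with
    | _ u v =>
      have huv : G.Adj u v := hM.1.1 _ he
      rcases lt_or_gt_of_ne (hG.dist_ne_of_adj ρ huv) with h | h
      · exact aux huv h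
      · rw [Sym2.eq_swap]
        exact aux huv.symm h
  have eq_of_mem {e f : Sym2 V} (he : e ∈ M) (hf : f ∈ M) {x : V} (hxe : x ∈ e) (hxf : x ∈ f) :
      e = f := by
    by_contra hne
    exact hM.1.2 e he f hf hne x hxe hxf
  have eq_of_adj {e f : Sym2 V} (he : e ∈ M) (hf : f ∈ M) {x y : V} (hx : x ∈ e) (hy : y ∈ f)
      (hxy : G.Adj x y) : e = f := by
    have h : s(x, y) ∈ M := hM.2 _ hxy fun z hz => by
      rcases Sym2.mem_iff.1 hz with rfl | rfl
      exacts [⟨e, he, hx⟩, ⟨f, hf, hy⟩]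
    exact (eq_of_mem he h hx (Sym2.mem_mk_left x y)).trans
      (eq_of_mem h hf (Sym2.mem_mk_right x y) hy)
  have : Nonempty V := ⟨ρ⟩
  choose! d hdD hd using hdom
  refine Finset.card_le_card_of_injOn d hdD fun e he f hf hef => ?_
  have hde := hd e he
  have hdf := hd f hf
  rw [← hef] at hdf
  rcases hde with hde | ⟨v, hv, hvd, hvlt⟩ <;> rcases hdf with hdf | ⟨w, hw, hwd, hwlt⟩
  · exact eq_of_mem he hf hde hdf
  · exact eq_of_adj he hf hde hw hwd.symm
  · exact eq_of_adj he hf hv hdf hvd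
  · obtain rfl := hG.eq_of_adj_of_dist_lt hvd hwd hvlt hwlt
    exact eq_of_mem he hf hv hw

/-- Let `G` be a tree on `n` vertices with induced matching number `r` and maximum
cardinality of a minimal vertex cover `p`. Then `p ≤ n - r`. -/
theorem tauMax_le_of_isTree {n : ℕ} (G : SimpleGraph (Fin n)) (hG : G.IsTree) (r p : ℕ)
    (hr : inducedMatchingNumber G = r) (hp : tauMax G = p) :
    p ≤ n - r := by
  subst hr hp
  refine csSup_le' ?_
  rintro _ ⟨C, hC, rfl⟩
  have hdom (v : Fin n) : v ∈ Cᶜ ∨ ∃ w ∈ Cᶜ, G.Adj v w := by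
    by_cases hv : v ∈ C
    · obtain ⟨w, hvw, hw⟩ := hC.exists_adj_notMem hv
      exact Or.inr ⟨w, Finset.mem_compl.2 hw, hvw⟩
    · exact Or.inl (Finset.mem_compl.2 hv)
  have hind : inducedMatchingNumber G ≤ Cᶜ.card := by
    refine csSup_le' ?_
    rintro _ ⟨M, hM, rfl⟩
    exact hM.card_le_of_dominating hG hdom
  have hcard := C.card_add_card_compl
  rw [Fintype.card_fin] at hcard
  omega
end

section
/- Let n ≥ 4 and let p, r be integers with 1 ≤ r < n/2 and ⌈n/2⌉ ≤ p ≤ n − r. Then there exists a tree G on n vertices with induced matching number indm(G) = r and maximum minimal vertex cover size τ_max(G) = p. -/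
variable {V : Type*}

/-- The parent function of a rooted tree with root `0`: the root has the child `1`, the further
children `2 * i` for `1 ≤ i < r`, each of which has the only child `2 * i + 1`, and `a` leaves
`2 * r, …, 2 * r + a - 1`; all larger vertices are leaves attached to `1`. -/
def leggedParent (r a v : ℕ) : ℕ :=
  if v < 2 * r then (if v % 2 = 1 then v - 1 else 0) else if v < 2 * r + a then 0 else 1

/-- The double star with centres `0` and `1`, with `a` leaves at `0` and the last vertices as
leaves at `1`, and with `r - 1` additional paths of length two starting at `0`. -/
def leggedDoubleStar (n r a : ℕ) : SimpleGraph (Fin n) :=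
  SimpleGraph.fromRel fun u v => leggedParent r a u = v

theorem leggedDoubleStar_adj {n r a : ℕ} {u v : Fin n} :
    (leggedDoubleStar n r a).Adj u v ↔
      (u : ℕ) ≠ v ∧ (leggedParent r a u = v ∨ leggedParent r a v = u) := by
  simp [leggedDoubleStar, SimpleGraph.fromRel_adj, Fin.ext_iff]

theorem leggedParent_lt {r a v : ℕ} (hr : 1 ≤ r) (hv : v ≠ 0) : leggedParent r a v < v := by
  unfold leggedParent
  split_ifs <;> omega

theorem leggedDoubleStar_edge_eq {n r a : ℕ} (hr : 1 ≤ r) {e : Sym2 (Fin n)}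
    (he : e ∈ (leggedDoubleStar n r a).edgeSet) :
    ∃ u v : Fin n, (v : ℕ) ≠ 0 ∧ (u : ℕ) = leggedParent r a v ∧ e = s(u, v) := by
  induction e with
  | _ u v =>
    rw [SimpleGraph.mem_edgeSet, leggedDoubleStar_adj] at he
    have h0 : leggedParent r a 0 = 0 := by
      unfold leggedParent
      split_ifs <;> omega
    obtain ⟨hne, h | h⟩ := he
    · refine ⟨v, u, fun hu => hne ?_, h.symm, Sym2.eq_swap⟩
      rw [hu, h0] at h
      omega
    · refine ⟨u, v, fun hv => hne ?_, h.symm, rfl⟩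
      rw [hv, h0] at h
      omega

theorem leggedDoubleStar_isTree {n r a : ℕ} (hr : 1 ≤ r) (hn : 0 < n) :
    (leggedDoubleStar n r a).IsTree := by
  classical
  have hreach : ∀ k (hk : k < n), (leggedDoubleStar n r a).Reachable ⟨k, hk⟩ ⟨0, hn⟩ := by
    intro k
    induction k using Nat.strong_induction_on with
    | _ k ih =>
      intro hk
      by_cases h0 : k = 0
      · subst h0
        exact SimpleGraph.Reachable.refl _
      · have hlt := leggedParent_lt (a := a) hr h0
        refine SimpleGraph.Reachable.trans (SimpleGraph.Adj.reachable ?_)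
          (ih _ hlt (hlt.trans hk))
        rw [leggedDoubleStar_adj]
        exact ⟨hlt.ne', Or.inl rfl⟩
  have hconn : (leggedDoubleStar n r a).Connected := by
    have : Nonempty (Fin n) := ⟨⟨0, hn⟩⟩
    exact ⟨fun u v => (hreach u u.2).trans (hreach v v.2).symm⟩
  rw [SimpleGraph.isTree_iff_connected_and_card]
  refine ⟨hconn, le_antisymm ?_ hconn.card_vert_le_card_edgeSet_add_one⟩
  let top : Sym2 (Fin n) → Fin n := fun e => e.sup
  have hsub : Set.InjOn top (leggedDoubleStar n r a).edgeSet := by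
    intro e he f hf hef
    obtain ⟨u, v, hv, hu, rfl⟩ := leggedDoubleStar_edge_eq hr he
    obtain ⟨u', v', hv', hu', rfl⟩ := leggedDoubleStar_edge_eq hr hf
    have h1 := leggedParent_lt (a := a) hr hv
    have h2 := leggedParent_lt (a := a) hr hv'
    have huv : u ≤ v := by rw [Fin.le_def]; omega
    have huv' : u' ≤ v' := by rw [Fin.le_def]; omega
    have hvv : v = v' := by simpa [top, Sym2.sup_mk, huv, huv'] using hef
    subst hvv
    rw [Fin.ext (hu.trans hu'.symm)]
  have hmaps : Set.MapsTo top (leggedDoubleStar n r a).edgeSet {v | v ≠ ⟨0, hn⟩} := by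
    intro e he
    obtain ⟨u, v, hv, hu, rfl⟩ := leggedDoubleStar_edge_eq hr he
    have h1 := leggedParent_lt (a := a) hr hv
    have huv : u ≤ v := by rw [Fin.le_def]; omega
    simpa [top, Sym2.sup_mk, huv, Fin.ext_iff] using hv
  have hcard := Set.ncard_le_ncard_of_injOn top hmaps hsub
  have hcompl : ({v | v ≠ ⟨0, hn⟩} : Set (Fin n)).ncard + 1 = n := by
    have h := Set.ncard_add_ncard_compl ({⟨0, hn⟩} : Set (Fin n))
    rw [Set.ncard_singleton, Nat.card_eq_fintype_card, Fintype.card_fin] at h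
    rw [add_comm]
    exact h
  rw [Nat.card_coe_set_eq, Nat.card_eq_fintype_card, Fintype.card_fin]
  omega

theorem IsMatchingFinset.eq_of_mem {G : SimpleGraph V} {M : Finset (Sym2 V)}
    (hM : IsMatchingFinset G M) {e f : Sym2 V} (he : e ∈ M) (hf : f ∈ M) {v : V}
    (hve : v ∈ e) (hvf : v ∈ f) : e = f :=
  by_contra fun h => hM.2 e he f hf h v hve hvf

theorem card_le_of_isInducedMatchingFinset_leggedDoubleStar {n r a : ℕ} (hr : 1 ≤ r)
    {M : Finset (Sym2 (Fin n))} (hM : IsInducedMatchingFinset (leggedDoubleStar n r a) M) :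
    M.card ≤ r := by
  classical
  let leg : Fin n → ℕ := fun v => if (v : ℕ) < 2 * r then v / 2 else 0
  rw [← Finset.card_range r]
  refine Finset.card_le_card_of_injOn (fun e => leg e.sup) ?_ ?_
  · intro e _
    simp only [leg, Finset.coe_range, Set.mem_Iio]
    split_ifs <;> omega
  · intro e he f hf hef
    obtain ⟨u, v, hv, hu, rfl⟩ := leggedDoubleStar_edge_eq hr (hM.1.1 e he)
    obtain ⟨u', v', hv', hu', rfl⟩ := leggedDoubleStar_edge_eq hr (hM.1.1 f hf)
    have h1 := leggedParent_lt (a := a) hr hv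
    have h2 := leggedParent_lt (a := a) hr hv'
    have huv : u ≤ v := by rw [Fin.le_def]; omega
    have huv' : u' ≤ v' := by rw [Fin.le_def]; omega
    simp only [Sym2.sup_mk, huv, huv', sup_of_le_right] at hef
    have hshare : u = u' ∨ u = v' ∨ v = u' ∨ v = v' ∨
        ((u : ℕ) = 0 ∧ (u' : ℕ) = 1) ∨ ((u : ℕ) = 1 ∧ (u' : ℕ) = 0) := by
      simp only [Fin.ext_iff]
      simp only [leg] at hef
      unfold leggedParent at hu hu'
      split_ifs at hef hu hu' <;> omega
    rcases hshare with h | h | h | h | h | h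
    · exact hM.1.eq_of_mem he hf (v := u) (by simp) (by simp [h])
    · exact hM.1.eq_of_mem he hf (v := u) (by simp) (by simp [h])
    · exact hM.1.eq_of_mem he hf (v := v) (by simp) (by simp [h])
    · exact hM.1.eq_of_mem he hf (v := v) (by simp) (by simp [h])
    all_goals
      have hmem : s(u, u') ∈ M := by
        refine hM.2 _ ?_ ?_
        · rw [SimpleGraph.mem_edgeSet, leggedDoubleStar_adj, h.1, h.2]
          have h01 : leggedParent r a 1 = 0 := by
            unfold leggedParent
            split_ifs <;> omega
          simp [h01]
        · intro w hw
          rcases Sym2.mem_iff.1 hw with rfl | rfl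
          · exact ⟨_, he, by simp⟩
          · exact ⟨_, hf, by simp⟩
      exact (hM.1.eq_of_mem he hmem (v := u) (by simp) (by simp)).trans
        (hM.1.eq_of_mem hmem hf (v := u') (by simp) (by simp))

theorem exists_isInducedMatchingFinset_leggedDoubleStar {n r a : ℕ} (hr : 1 ≤ r)
    (hn : 2 * r + a < n) :
    ∃ M, IsInducedMatchingFinset (leggedDoubleStar n r a) M ∧ M.card = r := by
  classical
  let lo : Fin r → Fin n := fun i => if (i : ℕ) = 0 then ⟨1, by omega⟩ else ⟨2 * i, by omega⟩
  let hi : Fin r → Fin n := fun i =>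
    if (i : ℕ) = 0 then ⟨2 * r + a, hn⟩ else ⟨2 * i + 1, by omega⟩
  have hlo : ∀ i, (lo i : ℕ) = if (i : ℕ) = 0 then 1 else 2 * (i : ℕ) := by
    intro i; simp only [lo]; split_ifs <;> rfl
  have hhi : ∀ i, (hi i : ℕ) = if (i : ℕ) = 0 then 2 * r + a else 2 * (i : ℕ) + 1 := by
    intro i; simp only [hi]; split_ifs <;> rfl
  have hdisj : ∀ i j, lo i = lo j ∨ lo i = hi j ∨ hi i = lo j ∨ hi i = hi j → i = j := by
    intro i j h
    simp only [Fin.ext_iff, hlo, hhi] at h ⊢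
    split_ifs at h <;> omega
  have hinj : Function.Injective fun i => s(lo i, hi i) := by
    intro i j h
    refine hdisj i j ?_
    rcases Sym2.eq_iff.1 h with h | h
    · exact Or.inl h.1
    · exact Or.inr (Or.inl h.1)
  refine ⟨Finset.univ.image fun i => s(lo i, hi i), ⟨⟨?_, ?_⟩, ?_⟩, ?_⟩
  · intro e he
    obtain ⟨i, -, rfl⟩ := Finset.mem_image.1 he
    rw [SimpleGraph.mem_edgeSet, leggedDoubleStar_adj, hlo, hhi]
    unfold leggedParent
    split_ifs <;> omega
  · intro e he f hf hne w hwe hwf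
    obtain ⟨i, -, rfl⟩ := Finset.mem_image.1 he
    obtain ⟨j, -, rfl⟩ := Finset.mem_image.1 hf
    refine hne (congrArg (fun i => s(lo i, hi i)) (hdisj i j ?_))
    rcases Sym2.mem_iff.1 hwe with rfl | rfl <;> rcases Sym2.mem_iff.1 hwf with h | h <;> simp [h]
  · intro e he hcov
    obtain ⟨u, v, hv, hu, rfl⟩ := leggedDoubleStar_edge_eq hr he
    have key : ∀ w ∈ s(u, v), ∃ i, w = lo i ∨ w = hi i := by
      intro w hw
      obtain ⟨f, hf, hwf⟩ := hcov w hw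
      obtain ⟨i, -, rfl⟩ := Finset.mem_image.1 hf
      exact ⟨i, Sym2.mem_iff.1 hwf⟩
    obtain ⟨i, hui⟩ := key u (by simp)
    obtain ⟨j, hvj⟩ := key v (by simp)
    have hij : u = lo j ∧ v = hi j := by
      simp only [Fin.ext_iff, hlo, hhi] at hui hvj ⊢
      unfold leggedParent at hu
      split_ifs at hui hvj hu ⊢ <;> omega
    rw [hij.1, hij.2]
    exact Finset.mem_image_of_mem _ (Finset.mem_univ j)
  · rw [Finset.card_image_of_injective _ hinj, Finset.card_univ, Fintype.card_fin]

theorem isMinimalVertexCover_of_exists_adj {G : SimpleGraph V} {C : Finset V}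
    (hC : IsVertexCover G C) (h : ∀ v ∈ C, ∃ w, G.Adj v w ∧ w ∉ C) :
    IsMinimalVertexCover G C := by
  refine ⟨hC, fun D hD hcov => ?_⟩
  obtain ⟨v, hv, hvD⟩ := Finset.exists_of_ssubset hD
  obtain ⟨w, hvw, hw⟩ := h v hv
  obtain ⟨z, hz, hze⟩ := hcov s(v, w) hvw
  rcases Sym2.mem_iff.1 hze with rfl | rfl
  · exact hvD hz
  · exact hw (hD.1 hz)

theorem exists_isMinimalVertexCover_leggedDoubleStar {n r a p : ℕ} (hr : 1 ≤ r)
    (hn : n = r + a + p) (hrp : r < p) :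
    ∃ C, IsMinimalVertexCover (leggedDoubleStar n r a) C ∧ C.card = p := by
  classical
  let c : Fin p → Fin n := fun i =>
    if h : (i : ℕ) < r then ⟨2 * i, by omega⟩ else ⟨i + r + a, by omega⟩
  have hc : ∀ i, (c i : ℕ) = if (i : ℕ) < r then 2 * (i : ℕ) else (i : ℕ) + r + a := by
    intro i; simp only [c]; split_ifs <;> rfl
  have hinj : Function.Injective c := by
    intro i j h
    simp only [Fin.ext_iff, hc] at h ⊢
    split_ifs at h <;> omega
  have hmem : ∀ v, v ∈ Finset.univ.image c ↔
      ((v : ℕ) < 2 * r ∧ (v : ℕ) % 2 = 0) ∨ 2 * r + a ≤ (v : ℕ) := by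
    intro v
    simp only [Finset.mem_image, Finset.mem_univ, true_and, Fin.ext_iff, hc]
    constructor
    · rintro ⟨i, hi⟩
      split_ifs at hi <;> omega
    · rintro (h | h)
      · refine ⟨⟨v / 2, by omega⟩, ?_⟩
        rw [if_pos (by dsimp only; omega)]
        dsimp only
        omega
      · refine ⟨⟨v - r - a, by omega⟩, ?_⟩
        rw [if_neg (by dsimp only; omega)]
        dsimp only
        omega
  refine ⟨Finset.univ.image c, isMinimalVertexCover_of_exists_adj ?_ ?_, ?_⟩
  · intro e he
    obtain ⟨u, v, hv, hu, rfl⟩ := leggedDoubleStar_edge_eq hr he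
    have huv : u ∈ Finset.univ.image c ∨ v ∈ Finset.univ.image c := by
      rw [hmem, hmem]
      unfold leggedParent at hu
      split_ifs at hu <;> omega
    rcases huv with h | h
    · exact ⟨u, h, by simp⟩
    · exact ⟨v, h, by simp⟩
  · intro v hv
    rw [hmem] at hv
    simp only [hmem, leggedDoubleStar_adj]
    rcases hv with hv | hv
    · refine ⟨⟨v + 1, by omega⟩, ?_⟩
      unfold leggedParent
      dsimp only
      split_ifs <;> omega
    · have h1 : leggedParent r a v = 1 := by
        unfold leggedParent
        split_ifs <;> omega
      exact ⟨⟨1, by omega⟩, ⟨by dsimp only; omega, Or.inl h1⟩, by dsimp only; omega⟩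
  · rw [Finset.card_image_of_injective _ hinj, Finset.card_univ, Fintype.card_fin]

theorem card_le_of_isMinimalVertexCover_leggedDoubleStar {n r a p : ℕ} (hr : 1 ≤ r)
    (hn : n = r + a + p) (hrp : r < p) (hap : r + a ≤ p) {C : Finset (Fin n)}
    (hC : IsMinimalVertexCover (leggedDoubleStar n r a) C) : C.card ≤ p := by
  have hcov : ∀ u v : Fin n, (leggedDoubleStar n r a).Adj u v → u ∈ C ∨ v ∈ C := by
    intro u v huv
    obtain ⟨w, hw, hwe⟩ := hC.1 s(u, v) huv
    rcases Sym2.mem_iff.1 hwe with rfl | rfl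
    · exact Or.inl hw
    · exact Or.inr hw
  have hleaf : ∀ u v : Fin n, u ∈ C → v ∈ C →
      (∀ w, (leggedDoubleStar n r a).Adj v w → w = u) → False := by
    intro u v hu hv h
    obtain ⟨w, hvw, hw⟩ := hC.exists_adj_notMem hv
    exact hw (h w hvw ▸ hu)
  have hleg : ∀ u v : Fin n, u ∈ C → v ∈ C → 2 ≤ (u : ℕ) → (v : ℕ) < 2 * r →
      (u : ℕ) % 2 = 0 → (v : ℕ) ≠ u + 1 := by
    intro u v hu hv h1 h2 h3 h4
    refine hleaf u v hu hv fun w hw => ?_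
    rw [leggedDoubleStar_adj] at hw
    rw [Fin.ext_iff]
    unfold leggedParent at hw
    split_ifs at hw <;> omega
  let x : Fin n := ⟨0, by omega⟩
  let y : Fin n := ⟨1, by omega⟩
  have hx : (x : ℕ) = 0 := rfl
  have hy : (y : ℕ) = 1 := rfl
  have hxy : x ∈ C ∨ y ∈ C := by
    refine hcov x y ?_
    rw [leggedDoubleStar_adj, hx, hy]
    unfold leggedParent
    split_ifs <;> omega
  have hxleaf : x ∈ C → ∀ v ∈ C, (v : ℕ) < 2 * r ∨ 2 * r + a ≤ v := by
    intro hxC v hv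
    by_contra! h
    refine hleaf x v hxC hv fun w hw => ?_
    rw [leggedDoubleStar_adj] at hw
    rw [Fin.ext_iff, hx]
    unfold leggedParent at hw
    split_ifs at hw <;> omega
  have hyleaf : y ∈ C → ∀ v ∈ C, (v : ℕ) < 2 * r + a := by
    intro hyC v hv
    by_contra! h
    refine hleaf y v hyC hv fun w hw => ?_
    rw [leggedDoubleStar_adj] at hw
    rw [Fin.ext_iff, hy]
    unfold leggedParent at hw
    split_ifs at hw <;> omega
  have hxval : ∀ v ∈ C, (v : ℕ) = 0 → x ∈ C := by
    intro v hv h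
    rwa [show x = v from Fin.ext h.symm]
  have hyval : ∀ v ∈ C, (v : ℕ) = 1 → y ∈ C := by
    intro v hv h
    rwa [show y = v from Fin.ext h.symm]
  let shift : ℕ := if y ∈ C then r else r + a
  let φ : Fin n → ℕ := fun v =>
    if (v : ℕ) = 1 ∧ x ∈ C then r else if (v : ℕ) < 2 * r then v / 2 else v - shift
  rw [← Finset.card_range p]
  refine Finset.card_le_card_of_injOn φ ?_ ?_
  · intro v hv
    rw [Finset.mem_coe] at hv
    simp only [φ, shift, Finset.coe_range, Set.mem_Iio]
    have hv1 := fun h => hxleaf h v hv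
    have hv2 := fun h => hyleaf h v hv
    split_ifs <;> grind
  · intro v hv w hw hvw
    rw [Finset.mem_coe] at hv hw
    have hv1 := fun h => hxleaf h v hv
    have hv2 := fun h => hyleaf h v hv
    have hw1 := fun h => hxleaf h w hw
    have hw2 := fun h => hyleaf h w hw
    have hv3 := hxval v hv
    have hv4 := hyval v hv
    have hw3 := hxval w hw
    have hw4 := hyval w hw
    have h1 := hleg v w hv hw
    have h2 := hleg w v hw hv
    clear hcov hleaf hleg hxleaf hyleaf hxval hyval
    simp only [φ, shift] at hvw
    rw [Fin.ext_iff]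
    by_cases hxC : x ∈ C <;> by_cases hyC : y ∈ C <;>
      simp only [hxC, hyC, forall_const, and_true, and_false, if_true, if_false, imp_false,
        or_self, false_imp_iff, imp_true_iff] at hxy hv1 hv2 hv3 hv4 hw1 hw2 hw3 hw4 hvw
    all_goals
      split_ifs at hvw <;> omega

/-- Let `n ≥ 4` and let `p, r` be integers with `1 ≤ r < n/2` and `⌈n/2⌉ ≤ p ≤ n - r`.
Then there exists a tree `G` on `n` vertices with `indm(G) = r` and `τ_max(G) = p`. -/
theorem exists_tree_with_inducedMatchingNumber_tauMax (n r p : ℕ) (hn : 4 ≤ n)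
    (hr1 : 1 ≤ r) (hr2 : 2 * r < n) (hp1 : (n + 1) / 2 ≤ p) (hp2 : p ≤ n - r) :
    ∃ G : SimpleGraph (Fin n), G.IsTree ∧ inducedMatchingNumber G = r ∧ tauMax G = p := by
  obtain ⟨a, ha⟩ : ∃ a, n = r + a + p := ⟨n - p - r, by omega⟩
  refine ⟨leggedDoubleStar n r a, leggedDoubleStar_isTree hr1 (by omega), ?_, ?_⟩
  · refine IsGreatest.csSup_eq ⟨exists_isInducedMatchingFinset_leggedDoubleStar hr1 (by omega), ?_⟩
    rintro m ⟨M, hM, rfl⟩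
    exact card_le_of_isInducedMatchingFinset_leggedDoubleStar hr1 hM
  · refine IsGreatest.csSup_eq
      ⟨exists_isMinimalVertexCover_leggedDoubleStar hr1 ha (by omega), ?_⟩
    rintro m ⟨C, hC, rfl⟩
    exact card_le_of_isMinimalVertexCover_leggedDoubleStar hr1 ha (by omega) (by omega) hC
end

section
/- Let G be a tree, let M = {e_1,...,e_r} be an induced matching of G with e_i = {x_i, y_i}, let C be a minimal vertex cover of G, and suppose e_1,...,e_a are exactly the edges of M contained in C (a ≥ 1). Let U = V(G) \ (e_1 ∪ ... ∪ e_r), and for each i ∈ [a] choose u_i, v_i ∈ U \ C with {x_i,u_i}, {y_i,v_i} ∈ E(G). Then |{u_1,v_1,...,u_a,v_a}| ≥ a + 1. -/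
variable {V : Type*}

/-- A finite acyclic graph on a nonempty vertex set has fewer edges than vertices. -/
theorem SimpleGraph.IsAcyclic.card_edgeFinset_add_one_le {W : Type*} [Fintype W] [Nonempty W]
    {G : SimpleGraph W} [Fintype G.edgeSet] (hG : G.IsAcyclic) :
    G.edgeFinset.card + 1 ≤ Fintype.card W := by
  classical
  obtain ⟨T, hGT, -, hT⟩ :=
    (SimpleGraph.connected_top (V := W)).exists_isTree_le_of_le_of_isAcyclic le_top hG
  rw [← hT.card_edgeFinset]
  exact Nat.add_le_add_right (Finset.card_le_card (SimpleGraph.edgeFinset_mono hGT)) 1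

/-- In an acyclic graph, a nonempty finite set of vertices spans fewer edges than it has
elements. -/
theorem SimpleGraph.IsAcyclic.card_add_one_le_of_subset_sym2 {W : Type*} [Fintype W]
    [DecidableEq W] {G : SimpleGraph W} (hG : G.IsAcyclic) {T : Finset W} (hT : T.Nonempty)
    {E : Finset (Sym2 W)} (hE : ∀ e ∈ E, e ∈ G.edgeSet) (hET : E ⊆ T.sym2) :
    E.card + 1 ≤ T.card := by
  classical
  have : Nonempty (T : Set W) := hT.to_subtype
  have hle := (hG.induce (T : Set W)).card_edgeFinset_add_one_le
  have hsub : E ⊆ (G.induce (T : Set W)).edgeFinset.map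
      (Function.Embedding.subtype (· ∈ (T : Set W))).sym2Map := by
    rintro ⟨p, q⟩ he
    obtain ⟨hp, hq⟩ := Finset.mk_mem_sym2_iff.1 (hET he)
    exact Finset.mem_map.2 ⟨s(⟨p, hp⟩, ⟨q, hq⟩), by simpa using hE _ he, rfl⟩
  have hcard := Finset.card_le_card hsub
  rw [Finset.card_map] at hcard
  rw [show Fintype.card (T : Set W) = T.card by simp] at hle
  omega

/-- Let `G` be a tree, `M = {e_1, …, e_r}` an induced matching of `G` with
`e_i = {x_i, y_i}`, and `C` a minimal vertex cover of `G` such that `e_1, …, e_a` are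
exactly the edges of `M` contained in `C` (`a ≥ 1`). Let
`U = V(G) \ (e_1 ∪ ⋯ ∪ e_r)` and for each `i ∈ [a]` pick `u_i, v_i ∈ U \ C` with
`{x_i, u_i}, {y_i, v_i} ∈ E(G)`. Then `|{u_1, v_1, …, u_a, v_a}| ≥ a + 1`. -/
theorem card_neighbors_ge_of_tree {W : Type*} [Fintype W] [DecidableEq W]
    (G : SimpleGraph W) (hG : G.IsTree) (r a : ℕ) (ha1 : 1 ≤ a) (har : a ≤ r)
    (x y : Fin r → W)
    (hM : IsInducedMatchingFinset G
      ((Finset.univ : Finset (Fin r)).image fun i => s(x i, y i)))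
    (hMcard : ((Finset.univ : Finset (Fin r)).image fun i => s(x i, y i)).card = r)
    (C : Finset W) (hC : IsMinimalVertexCover G C)
    (hain : ∀ i : Fin r, (x i ∈ C ∧ y i ∈ C) ↔ (i : ℕ) < a)
    (u v : Fin a → W)
    (huU : ∀ i : Fin a, ∀ j : Fin r, u i ≠ x j ∧ u i ≠ y j ∧ v i ≠ x j ∧ v i ≠ y j)
    (huC : ∀ i : Fin a, u i ∉ C ∧ v i ∉ C)
    (hadj : ∀ i : Fin a,
      G.Adj (x (Fin.castLE har i)) (u i) ∧ G.Adj (y (Fin.castLE har i)) (v i)) :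
    a + 1 ≤ (Finset.image u Finset.univ ∪ Finset.image v Finset.univ).card := by
  have hinj : Function.Injective fun i => s(x i, y i) :=
    Set.injOn_univ.1 (by simpa using Finset.card_image_iff.1 (hMcard.trans (by simp)))
  have hxy : ∀ i, x i ≠ y i := fun i =>
    ((SimpleGraph.mem_edgeSet G).1
      (hM.1.1 _ (Finset.mem_image_of_mem (fun i => s(x i, y i)) (Finset.mem_univ i)))).ne
  have hdisj : ∀ i j, i ≠ j → x i ≠ x j ∧ x i ≠ y j ∧ y i ≠ x j ∧ y i ≠ y j := by
    intro i j hij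
    have h := hM.1.2 _ (Finset.mem_image_of_mem (fun i => s(x i, y i)) (Finset.mem_univ i))
      _ (Finset.mem_image_of_mem (fun i => s(x i, y i)) (Finset.mem_univ j)) (hinj.ne hij)
    have hx := h (x i) (by simp)
    have hy := h (y i) (by simp)
    simp only [Sym2.mem_iff, not_or] at hx hy
    exact ⟨hx.1, hx.2, hy.1, hy.2⟩
  let c : Fin a → Fin r := Fin.castLE har
  have hc : Function.Injective c := Fin.castLE_injective har
  let f : Fin a ⊕ Fin a ⊕ Fin a → Sym2 W :=
    Sum.elim (fun i => s(x (c i), y (c i)))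
      (Sum.elim (fun i => s(x (c i), u i)) (fun i => s(y (c i), v i)))
  have hf : Function.Injective f := by
    have key : ∀ i j, i ≠ j → x (c i) ≠ x (c j) ∧ x (c i) ≠ y (c j) ∧ y (c i) ≠ x (c j) ∧
        y (c i) ≠ y (c j) := fun i j hij => hdisj _ _ (hc.ne hij)
    have hxy' : ∀ i j, x (c i) ≠ y (c j) := fun i j => by
      by_cases h : i = j
      · exact h ▸ hxy (c i)
      · exact (key i j h).2.1
    have hU : ∀ i j, u i ≠ x (c j) ∧ u i ≠ y (c j) ∧ v i ≠ x (c j) ∧ v i ≠ y (c j) :=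
      fun i j => huU i (c j)
    rintro (i | i | i) (j | j | j) h <;>
      simp only [f, Sum.elim_inl, Sum.elim_inr, Sym2.eq_iff] at h <;> grind
  let S := Finset.image u Finset.univ ∪ Finset.image v Finset.univ
  let T := S ∪ (Finset.univ.image (x ∘ c) ∪ Finset.univ.image (y ∘ c))
  have hT : T.Nonempty := ⟨u ⟨0, ha1⟩, by simp [T, S]⟩
  have hE : ∀ e ∈ Finset.univ.image f, e ∈ G.edgeSet := by
    simp only [Finset.mem_image, Finset.mem_univ, true_and, forall_exists_index,
      forall_apply_eq_imp_iff]
    rintro (i | i | i)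
    · exact hM.1.1 _ (Finset.mem_image_of_mem (fun i => s(x i, y i)) (Finset.mem_univ (c i)))
    · exact (hadj i).1
    · exact (hadj i).2
  have hET : Finset.univ.image f ⊆ T.sym2 := by
    intro e he
    obtain ⟨i | i | i, -, rfl⟩ := Finset.mem_image.1 he <;> simp [f, T, S]
  have hle := hG.isAcyclic.card_add_one_le_of_subset_sym2 hT hE hET
  rw [Finset.card_image_of_injective _ hf] at hle
  simp only [Finset.card_univ, Fintype.card_sum, Fintype.card_fin] at hle
  have hTS : T.card ≤ S.card + (a + a) :=
    (Finset.card_union_le _ _).trans <| Nat.add_le_add_left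
      ((Finset.card_union_le _ _).trans <| Nat.add_le_add
        (Finset.card_image_le.trans (by simp)) (Finset.card_image_le.trans (by simp))) _
  change a + 1 ≤ S.card
  omega
end

section
/- Let r ≥ 3, t ≥ 0 and 3 ≤ a ≤ r be integers, and let G be the graph on the n = 2r + 2 + t vertices {u_1,...,u_r, v_1,...,v_r, x, y, z_1,...,z_t} with edge set {{u_i,v_i} : i ∈ [r]} ∪ {{x,v_i} : i ∈ [a]} ∪ {{y,u_i} : i ∈ [r]} ∪ {{y,z_i} : i ∈ [t]}. Then G is a connected bipartite graph on n vertices, the induced matching number of G equals r, and the maximum cardinality of a minimal vertex cover of G is at least a + r + t. -/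
variable {V : Type*}

/-- A matching is no larger than any finite set of vertices meeting all of its edges. -/
theorem IsMatchingFinset.card_le_of_cover {G : SimpleGraph V} {M : Finset (Sym2 V)}
    (hM : IsMatchingFinset G M) (S : Finset V) (hS : ∀ e ∈ M, ∃ v ∈ S, v ∈ e) :
    M.card ≤ S.card := by
  refine Finset.card_le_card_of_forall_subsingleton (fun e v => v ∈ e) hS ?_
  rintro v - e ⟨he, hve⟩ f ⟨hf, hvf⟩
  by_contra hne
  exact hM.2 e he f hf hne v hve hvf

/-- A vertex cover in which every vertex has a neighbour outside is minimal. -/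
theorem IsVertexCover.isMinimal {G : SimpleGraph V} {C : Finset V} (hC : IsVertexCover G C)
    (h : ∀ v ∈ C, ∃ w ∉ C, G.Adj v w) : IsMinimalVertexCover G C := by
  refine ⟨hC, fun D hD hcov => ?_⟩
  obtain ⟨v, hvC, hvD⟩ := Finset.exists_of_ssubset hD
  obtain ⟨w, hw, hvw⟩ := h v hvC
  obtain ⟨z, hzD, hz⟩ := hcov s(v, w) hvw
  rcases Sym2.mem_iff.1 hz with rfl | rfl
  · exact hvD hzD
  · exact hw (hD.1 hzD)

theorem IsMinimalVertexCover.card_le_tauMax [Fintype V] {G : SimpleGraph V} {C : Finset V}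
    (hC : IsMinimalVertexCover G C) : C.card ≤ tauMax G :=
  le_csSup ⟨Fintype.card V, by rintro _ ⟨D, -, rfl⟩; exact D.card_le_univ⟩ ⟨C, hC, rfl⟩

/-- The induced matching number is `r` as soon as some induced matching has size `r` and none
is larger. -/
theorem inducedMatchingNumber_eq {G : SimpleGraph V} {r : ℕ} (M : Finset (Sym2 V))
    (hM : IsInducedMatchingFinset G M) (hr : M.card = r)
    (hle : ∀ N : Finset (Sym2 V), IsInducedMatchingFinset G N → N.card ≤ r) :
    inducedMatchingNumber G = r :=
  IsGreatest.csSup_eq ⟨⟨M, hM, hr⟩, by rintro _ ⟨N, hN, rfl⟩; exact hle N hN⟩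

/-- The adjacency relation of the construction, oriented from `u` to `v`, from `x` to `v`, and
from `y` to `u` and `z`, in terms of the values of the vertices. -/
def ConstructionRel (r a p q : ℕ) : Prop :=
  (p < r ∧ q = r + p) ∨ (p = 2 * r ∧ r ≤ q ∧ q < r + a) ∨ (p = 2 * r + 1 ∧ q < r) ∨
    (p = 2 * r + 1 ∧ 2 * r + 2 ≤ q)

section Construction

variable {r t a : ℕ} {G : SimpleGraph (Fin (2 * r + 2 + t))}

theorem connected_of_adj_iff (hr : 0 < r) (ha : 0 < a)
    (hG : ∀ p q, G.Adj p q ↔ ConstructionRel r a p q ∨ ConstructionRel r a q p) :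
    G.Connected := by
  unfold ConstructionRel at hG
  let y : Fin (2 * r + 2 + t) := ⟨2 * r + 1, by omega⟩
  have hu (p : Fin (2 * r + 2 + t)) (hp : p.1 < r) : G.Reachable p y :=
    SimpleGraph.Adj.reachable ((hG _ _).2 (by simp only [y, true_and]; omega))
  have hv (p : Fin (2 * r + 2 + t)) (hp : r ≤ p.1) (hp' : p.1 < 2 * r) : G.Reachable p y := by
    let u : Fin (2 * r + 2 + t) := ⟨p - r, by omega⟩
    have hpu : G.Adj p u := (hG _ _).2 (by simp only [u]; omega)
    exact hpu.reachable.trans (hu u (by simp only [u]; omega))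
  have hy (p : Fin (2 * r + 2 + t)) : G.Reachable p y := by
    rcases lt_or_ge p.1 r with h | h
    · exact hu p h
    rcases lt_or_ge p.1 (2 * r) with h' | h'
    · exact hv p h h'
    rcases eq_or_ne p y with rfl | hpy
    · rfl
    have hne : p.1 ≠ 2 * r + 1 := fun h => hpy (Fin.ext h)
    rcases eq_or_ne p.1 (2 * r) with hx | hx
    · let v : Fin (2 * r + 2 + t) := ⟨r, by omega⟩
      have hpv : G.Adj p v := (hG _ _).2 (by simp only [v]; omega)
      exact hpv.reachable.trans (hv v le_rfl (by simp only [v]; omega))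
    · exact SimpleGraph.Adj.reachable ((hG _ _).2 (by simp only [y, true_and]; omega))
  exact (SimpleGraph.connected_iff _).2 ⟨fun p q => (hy p).trans (hy q).symm, ⟨y⟩⟩

theorem isBipartite_of_adj_iff (ha : a ≤ r)
    (hG : ∀ p q, G.Adj p q ↔ ConstructionRel r a p q ∨ ConstructionRel r a q p) :
    IsBipartite G := by
  unfold ConstructionRel at hG
  refine ⟨{p | p.1 < r ∨ p.1 = 2 * r ∨ 2 * r + 2 ≤ p.1},
    {p | (r ≤ p.1 ∧ p.1 < 2 * r) ∨ p.1 = 2 * r + 1}, ?_, ?_, ?_, ?_⟩ <;>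
  simp only [hG, Set.mem_ofPred_eq] <;> intros <;> omega

theorem card_le_of_adj_iff (hr : 2 ≤ r)
    (hG : ∀ p q, G.Adj p q ↔ ConstructionRel r a p q ∨ ConstructionRel r a q p)
    (ha : a ≤ r) {N : Finset (Sym2 (Fin (2 * r + 2 + t)))} (hN : IsInducedMatchingFinset G N) :
    N.card ≤ r := by
  unfold ConstructionRel at hG
  let x : Fin (2 * r + 2 + t) := ⟨2 * r, by omega⟩
  let y : Fin (2 * r + 2 + t) := ⟨2 * r + 1, by omega⟩
  by_cases hy : ∃ e ∈ N, y ∈ e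
  · refine (hN.1.card_le_of_cover {x, y} fun e he => ?_).trans (Finset.card_le_two.trans hr)
    by_contra! hxy
    have hx : x ∉ e := hxy x (by simp)
    have hye : y ∉ e := hxy y (by simp)
    have hu : ∃ u ∈ e, u.1 < r := by
      have hadj := hN.1.1 e he
      induction e with | _ p q
      rw [SimpleGraph.mem_edgeSet, hG] at hadj
      simp only [Sym2.mem_iff, not_or, Fin.ext_iff, x, y] at hx hye
      rcases lt_or_ge p.1 r with h | h
      · exact ⟨p, by simp, h⟩
      · exact ⟨q, by simp, by omega⟩
    obtain ⟨u, hue, hur⟩ := hu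
    have hyu : s(y, u) ∈ N := by
      refine hN.2 _ ((hG _ _).2 (by simp only [y, true_and]; omega)) fun w hw => ?_
      rcases Sym2.mem_iff.1 hw with rfl | rfl
      · exact hy
      · exact ⟨e, he, hue⟩
    refine hN.1.2 e he _ hyu ?_ u hue (by simp)
    rintro rfl
    exact hye (by simp)
  · push Not at hy
    let v : Fin r → Fin (2 * r + 2 + t) := fun i => ⟨r + i, by omega⟩
    have hcard : (Finset.univ.image v).card ≤ r := Finset.card_image_le.trans (by simp)
    refine (hN.1.card_le_of_cover _ fun e he => ?_).trans hcard
    have hadj := hN.1.1 e he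
    have hye := hy e he
    induction e with | _ p q
    rw [SimpleGraph.mem_edgeSet, hG] at hadj
    simp only [Sym2.mem_iff, not_or, Fin.ext_iff, y] at hye
    have hmem (w : Fin (2 * r + 2 + t)) (h : r ≤ w.1) (h' : w.1 < 2 * r) :
        w ∈ Finset.univ.image v :=
      Finset.mem_image.2 ⟨⟨w - r, by omega⟩, by simp, Fin.ext (by simp only [v]; omega)⟩
    by_cases hp : r ≤ p.1 ∧ p.1 < 2 * r
    · exact ⟨p, hmem p hp.1 hp.2, by simp⟩
    · exact ⟨q, hmem q (by omega) (by omega), by simp⟩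

theorem inducedMatchingNumber_of_adj_iff (hr : 2 ≤ r) (ha : a ≤ r)
    (hG : ∀ p q, G.Adj p q ↔ ConstructionRel r a p q ∨ ConstructionRel r a q p) :
    inducedMatchingNumber G = r := by
  let e : Fin r → Sym2 (Fin (2 * r + 2 + t)) := fun i =>
    s(⟨i, by omega⟩, ⟨r + i, by omega⟩)
  have mem_e (i : Fin r) (w : Fin (2 * r + 2 + t)) :
      w ∈ e i ↔ w.1 = i ∨ w.1 = r + i := by
    simp [e, Fin.ext_iff]
  have eq_of_mem {i j : Fin r} {w : Fin (2 * r + 2 + t)} (hi : w ∈ e i) (hj : w ∈ e j) :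
      i = j := by
    rw [mem_e] at hi hj
    exact Fin.ext (by omega)
  have he : Function.Injective e := fun i j h =>
    eq_of_mem (w := ⟨i, by omega⟩) (by simp [mem_e]) (by rw [← h]; simp [mem_e])
  refine inducedMatchingNumber_eq (Finset.univ.image e) ⟨⟨?_, ?_⟩, ?_⟩
    (by simp [Finset.card_image_of_injective _ he])
    fun N hN => card_le_of_adj_iff hr hG ha hN
  · simp only [Finset.mem_image, Finset.mem_univ, true_and, forall_exists_index,
      forall_apply_eq_imp_iff]
    intro i
    rw [SimpleGraph.mem_edgeSet, hG]
    simp [ConstructionRel]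
  · simp only [Finset.mem_image, Finset.mem_univ, true_and, forall_exists_index,
      forall_apply_eq_imp_iff]
    exact fun i j hne w hi hj => hne (congrArg e (eq_of_mem hi hj))
  · intro f hf hcov
    induction f with | _ p q
    rw [SimpleGraph.mem_edgeSet, hG] at hf
    unfold ConstructionRel at hf
    simp only [Finset.mem_image, Finset.mem_univ, true_and, exists_exists_eq_and, mem_e] at hcov
    obtain ⟨i, hi⟩ := hcov p (by simp)
    obtain ⟨j, hj⟩ := hcov q (by simp)
    refine Finset.mem_image.2 ⟨i, by simp, ?_⟩
    simp only [e, Sym2.eq_iff, Fin.ext_iff]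
    omega

theorem le_tauMax_of_adj_iff (ha1 : 0 < a) (ha2 : a ≤ r)
    (hG : ∀ p q, G.Adj p q ↔ ConstructionRel r a p q ∨ ConstructionRel r a q p) :
    a + r + t ≤ tauMax G := by
  unfold ConstructionRel at hG
  let C : Finset (Fin (2 * r + 2 + t)) := {p | p.1 < r + a ∨ 2 * r + 2 ≤ p.1}
  have mem_C (p : Fin (2 * r + 2 + t)) : p ∈ C ↔ p.1 < r + a ∨ 2 * r + 2 ≤ p.1 := by
    simp [C]
  have hcov : IsVertexCover G C := by
    intro e he
    induction e with | _ p q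
    rw [SimpleGraph.mem_edgeSet, hG] at he
    by_cases hp : p ∈ C
    · exact ⟨p, hp, by simp⟩
    · refine ⟨q, ?_, by simp⟩
      rw [mem_C] at hp ⊢
      omega
  have hmin : IsMinimalVertexCover G C := by
    refine hcov.isMinimal fun p hp => ?_
    rw [mem_C] at hp
    by_cases hv : r ≤ p.1 ∧ p.1 < r + a
    · exact ⟨⟨2 * r, by omega⟩, by simp only [mem_C]; omega, (hG _ _).2 (by simp only [true_and]; omega)⟩
    · exact ⟨⟨2 * r + 1, by omega⟩, by simp only [mem_C]; omega,
        (hG _ _).2 (by simp only [true_and]; omega)⟩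
  refine le_trans ?_ hmin.card_le_tauMax
  let f : Fin (a + r + t) → Fin (2 * r + 2 + t) := fun k =>
    if h : k.1 < r + a then ⟨k, by omega⟩ else ⟨k + (r + 2 - a), by omega⟩
  have hf (k : Fin (a + r + t)) :
      (k.1 < r + a ∧ (f k).1 = k) ∨ (r + a ≤ k.1 ∧ (f k).1 = k + (r + 2 - a)) := by
    by_cases h : k.1 < r + a
    · simp [f, h]
    · simp [f, h, not_lt.1 h]
  calc a + r + t = (Finset.univ : Finset (Fin (a + r + t))).card := by simp
    _ ≤ C.card := by
      refine Finset.card_le_card_of_injOn f (fun k _ => ?_) fun k _ l _ hkl => ?_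
      · have := hf k
        rw [Finset.mem_coe, mem_C]
        omega
      · have hk := hf k
        have hl := hf l
        rw [hkl] at hk
        exact Fin.ext (by omega)

end Construction

/-- Let `r ≥ 3`, `t ≥ 0`, `3 ≤ a ≤ r`, and let `G` be the graph on the `n = 2r + 2 + t`
vertices `{u_1, …, u_r, v_1, …, v_r, x, y, z_1, …, z_t}` (encoded in `Fin (2r+2+t)` as
`u_i = i - 1`, `v_i = r + i - 1`, `x = 2r`, `y = 2r + 1`, `z_i = 2r + 1 + i`) with edges
`{u_i, v_i}` for `i ∈ [r]`, `{x, v_i}` for `i ∈ [a]`, `{y, u_i}` for `i ∈ [r]` and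
`{y, z_i}` for `i ∈ [t]`. Then `G` is a connected bipartite graph on `n` vertices,
`indm(G) = r`, and `τ_max(G) ≥ a + r + t`. -/
theorem bipartite_construction_inducedMatching_tauMax (r t a : ℕ) (hr : 3 ≤ r)
    (ha1 : 3 ≤ a) (ha2 : a ≤ r) (G : SimpleGraph (Fin (2 * r + 2 + t)))
    (hG : G = SimpleGraph.fromRel (fun p q : Fin (2 * r + 2 + t) =>
      (∃ i, i < r ∧ (p : ℕ) = i ∧ (q : ℕ) = r + i) ∨
      (∃ i, i < a ∧ (p : ℕ) = 2 * r ∧ (q : ℕ) = r + i) ∨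
      (∃ i, i < r ∧ (p : ℕ) = 2 * r + 1 ∧ (q : ℕ) = i) ∨
      (∃ i, i < t ∧ (p : ℕ) = 2 * r + 1 ∧ (q : ℕ) = 2 * r + 2 + i))) :
    G.Connected ∧ IsBipartite G ∧ inducedMatchingNumber G = r ∧ a + r + t ≤ tauMax G := by
  have hadj (p q : Fin (2 * r + 2 + t)) :
      G.Adj p q ↔ ConstructionRel r a p q ∨ ConstructionRel r a q p := by
    have key (p q : Fin (2 * r + 2 + t)) :
        ((∃ i, i < r ∧ (p : ℕ) = i ∧ (q : ℕ) = r + i) ∨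
        (∃ i, i < a ∧ (p : ℕ) = 2 * r ∧ (q : ℕ) = r + i) ∨
        (∃ i, i < r ∧ (p : ℕ) = 2 * r + 1 ∧ (q : ℕ) = i) ∨
        (∃ i, i < t ∧ (p : ℕ) = 2 * r + 1 ∧ (q : ℕ) = 2 * r + 2 + i)) ↔
        ConstructionRel r a p q := by
      unfold ConstructionRel
      constructor
      · rintro (⟨i, h⟩ | ⟨i, h⟩ | ⟨i, h⟩ | ⟨i, h⟩) <;> omega
      · rintro (h | h | h | h)
        · exact Or.inl ⟨p, by omega⟩
        · exact Or.inr (Or.inl ⟨q - r, by omega⟩)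
        · exact Or.inr (Or.inr (Or.inl ⟨q, by omega⟩))
        · exact Or.inr (Or.inr (Or.inr ⟨q - (2 * r + 2), by omega⟩))
    rw [hG, SimpleGraph.fromRel_adj, key, key, and_iff_right_iff_imp, ne_eq, Fin.ext_iff]
    unfold ConstructionRel
    omega
  exact ⟨connected_of_adj_iff (by omega) (by omega) hadj, isBipartite_of_adj_iff ha2 hadj,
    inducedMatchingNumber_of_adj_iff (by omega) ha2 hadj,
    le_tauMax_of_adj_iff (by omega) ha2 hadj⟩
end
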